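/- Let ρ be a real-valued radial neutral Schwartz function on ℝ², let m > 0, I > 0, let v ∈ ℝ² with |v| < 1 and ω ∈ ℝ, and set P = P_{v,ω}, M = M_{v,ω}. Then for all Schwartz vector fields a, π : ℝ² → ℝ² with div a = 0 and div π = 0, one has the exact expansion H_{P,M}(A_{v,ω}+a, Π_{v,ω}+π) − H_{P,M}(A_{v,ω}, Π_{v,ω}) = ½∫_{ℝ²}(|π|² + |∇a|²)dy + ∫_{ℝ²} π(y)·(v·∇)a(y) dy + (1/(2m))|δp|² + (1/(2I))(δM)², where δp := ⟨π,∇_*A_{v,ω}⟩ + ⟨Π_{v,ω},∇_*a⟩ + ⟨π,∇_*a⟩ − ⟨a,ρ⟩ ∈ ℝ² and δM := ∫_{ℝ²}(Jy)·a(y)ρ(y)dy. -/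

import Mathlib

open MeasureTheory
open scoped RealInnerProductSpace BigOperators

noncomputable section

abbrev V2 : Type := EuclideanSpace ℝ (Fin 2)

/-- standard basis vector of ℝ² -/
def e2 (j : Fin 2) : V2 := EuclideanSpace.single j 1

/-- Fourier transform with normalization `(2π)⁻¹ ∫ e^{-ik·x} ρ(x) dx`. -/
def FT (ρ : V2 → ℝ) (k : V2) : ℂ :=
  ((2 * Real.pi : ℝ) : ℂ)⁻¹ * ∫ x : V2, Complex.exp (-Complex.I * ((⟪k, x⟫ : ℝ) : ℂ)) * (ρ x : ℂ)

/-- j-th partial derivative of a complex-valued function on ℝ². -/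
def pd (f : V2 → ℂ) (j : Fin 2) (k : V2) : ℂ := fderiv ℝ f k (e2 j)

/-- `|∇f(k)|²` for a complex-valued function on ℝ². -/
def gradNormSqC (f : V2 → ℂ) (k : V2) : ℝ := ∑ j, ‖pd f j k‖ ^ 2

/-- `D(k) = |k|² - (v·k)²`. -/
def Dv (v : V2) (k : V2) : ℝ := ‖k‖ ^ 2 - (⟪v, k⟫ : ℝ) ^ 2

/-- `(J ∇f)_j` where `J` has rows `(0,1)`, `(-1,0)`. -/
def Jgrad (f : V2 → ℂ) (j : Fin 2) (k : V2) : ℂ := ![pd f 1 k, -pd f 0 k] j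

/-- Fourier transform of the soliton field `A_{v,ω}`. -/
def Ahat (ρ : V2 → ℝ) (v : V2) (ω : ℝ) (j : Fin 2) (k : V2) : ℂ :=
  (((v j - k j * (⟪v, k⟫ : ℝ) / ‖k‖ ^ 2 : ℝ) : ℂ) * FT ρ k
      - Complex.I * (ω : ℂ) * Jgrad (FT ρ) j k) / ((Dv v k : ℝ) : ℂ)

/-- The soliton field `A_{v,ω}` (inverse Fourier transform of `Ahat`). -/
def Asol (ρ : V2 → ℝ) (v : V2) (ω : ℝ) (j : Fin 2) (y : V2) : ℝ :=
  (((2 * Real.pi : ℝ) : ℂ)⁻¹ *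
    ∫ k : V2, Complex.exp (Complex.I * ((⟪k, y⟫ : ℝ) : ℂ)) * Ahat ρ v ω j k).re

/-- The soliton field `Π_{v,ω} = -(v·∇) A_{v,ω}`. -/
def Pisol (ρ : V2 → ℝ) (v : V2) (ω : ℝ) (j : Fin 2) (y : V2) : ℝ :=
  - fderiv ℝ (Asol ρ v ω j) y v

/-- `|∇A(y)|² = ∑_{i,j} (∂_i A_j(y))²`. -/
def gradSq (A : Fin 2 → V2 → ℝ) (y : V2) : ℝ :=
  ∑ i, ∑ j, (fderiv ℝ (A j) y (e2 i)) ^ 2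

/-- Field energy `½∫ (|Π|² + |∇A|²)`. -/
def fieldEnergy (A Pf : Fin 2 → V2 → ℝ) : ℝ :=
  (1 / 2) * ∫ y : V2, ((∑ j, (Pf j y) ^ 2) + gradSq A y)

/-- `⟨Π, ∇_* A⟩_j = ∫ Π(y)·∂_j A(y) dy`. -/
def momTerm (A Pf : Fin 2 → V2 → ℝ) (j : Fin 2) : ℝ :=
  ∫ y : V2, ∑ l, Pf l y * fderiv ℝ (A l) y (e2 j)

/-- `⟨A, ρ⟩_j = ∫ A_j(y) ρ(y) dy`. -/
def chargeTerm (ρ : V2 → ℝ) (A : Fin 2 → V2 → ℝ) (j : Fin 2) : ℝ :=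
  ∫ y : V2, A j y * ρ y

/-- `∫ (Jy)·A(y) ρ(y) dy` where `(Jy) = (y₂, -y₁)`. -/
def angTerm (ρ : V2 → ℝ) (A : Fin 2 → V2 → ℝ) : ℝ :=
  ∫ y : V2, (y 1 * A 0 y - y 0 * A 1 y) * ρ y

/-- The reduced Hamiltonian `H_{P,M}(A,Π)`. -/
def Hred (m I : ℝ) (ρ : V2 → ℝ) (P : Fin 2 → ℝ) (M : ℝ) (A Pf : Fin 2 → V2 → ℝ) : ℝ :=
  fieldEnergy A Pf
    + (1 / (2 * m)) * ∑ j, (P j + momTerm A Pf j - chargeTerm ρ A j) ^ 2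
    + (1 / (2 * I)) * (M + angTerm ρ A) ^ 2

/-- The soliton linear momentum `P_{v,ω}`. -/
def Psol (ρ : V2 → ℝ) (m : ℝ) (v : V2) (ω : ℝ) (j : Fin 2) : ℝ :=
  m * v j - momTerm (Asol ρ v ω) (Pisol ρ v ω) j + chargeTerm ρ (Asol ρ v ω) j

/-- The soliton angular momentum `M_{v,ω}`. -/
def Msol (ρ : V2 → ℝ) (I : ℝ) (v : V2) (ω : ℝ) : ℝ :=
  I * ω - angTerm ρ (Asol ρ v ω)

open FourierTransform SchwartzMap LineDeriv

/-- A Schwartz function vanishing at the origin is bounded by `‖x‖ (1 + ‖x‖)⁻³`. -/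
theorem SchwartzMap.exists_norm_le_of_apply_zero (g : 𝓢(V2, ℂ)) (h0 : g 0 = 0) :
    ∃ C, 0 ≤ C ∧ ∀ x, ‖g x‖ ≤ C * (‖x‖ * ((1 + ‖x‖) ^ 3)⁻¹) := by
  obtain ⟨C₁, hC₁, h₁⟩ := (fderivCLM ℝ V2 ℂ g).decay 0 0
  have hlip : ∀ x, ‖g x‖ ≤ C₁ * ‖x‖ := by
    intro x
    have := Convex.norm_image_sub_le_of_norm_fderiv_le (𝕜 := ℝ) (f := g) (C := C₁) (s := Set.univ)
      (x := 0) (y := x) (fun y _ => g.differentiableAt) (fun y _ => by simpa using h₁ y)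
      convex_univ (Set.mem_univ _) (Set.mem_univ _)
    simpa [h0] using this
  set C₂ := (2 : ℝ) ^ 4 * ((Finset.Iic (4, 0)).sup fun m => SchwartzMap.seminorm ℝ m.1 m.2) g
    with hC₂
  have h₂ : ∀ x, (1 + ‖x‖) ^ 4 * ‖g x‖ ≤ C₂ := by
    intro x
    simpa using one_add_le_sup_seminorm_apply (𝕜 := ℝ) (m := (4, 0)) (k := 4) (n := 0)
      le_rfl le_rfl g x
  have hC₂0 : 0 ≤ C₂ := by positivity
  refine ⟨8 * C₁ + 2 * C₂, by positivity, fun x => ?_⟩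
  rw [← mul_assoc, ← div_eq_mul_inv, le_div_iff₀ (by positivity)]
  rcases le_total ‖x‖ 1 with hx | hx
  · calc ‖g x‖ * (1 + ‖x‖) ^ 3 ≤ (C₁ * ‖x‖) * (1 + 1) ^ 3 := by gcongr; exact hlip x
      _ ≤ _ := by nlinarith [norm_nonneg x, mul_nonneg hC₂0 (norm_nonneg x)]
  · calc ‖g x‖ * (1 + ‖x‖) ^ 3 ≤ ‖g x‖ * (1 + ‖x‖) ^ 3 * (1 + ‖x‖) :=
          le_mul_of_one_le_right (by positivity) (by linarith)
      _ = (1 + ‖x‖) ^ 4 * ‖g x‖ := by ring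
      _ ≤ C₂ := h₂ x
      _ ≤ _ := by nlinarith [norm_nonneg x, mul_nonneg hC₁.le (norm_nonneg x)]

theorem one_add_norm_pow_inv_eq_rpow {E : Type*} [SeminormedAddCommGroup E] (x : E) (n : ℕ) :
    ((1 + ‖x‖) ^ n)⁻¹ = (1 + ‖x‖) ^ (-(n : ℝ)) := by
  rw [Real.rpow_neg (by positivity), Real.rpow_natCast]

theorem integrable_one_add_norm_cube_inv : Integrable fun x : V2 => ((1 + ‖x‖) ^ 3)⁻¹ := by
  simp_rw [one_add_norm_pow_inv_eq_rpow]
  exact integrable_one_add_norm (by norm_num)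

theorem integrable_norm_inv_mul_one_add_norm_cube_inv :
    Integrable fun x : V2 => ‖x‖⁻¹ * ((1 + ‖x‖) ^ 3)⁻¹ := by
  rw [integrable_fun_norm_addHaar (μ := (volume : Measure V2))
    (f := fun r : ℝ => r⁻¹ * ((1 + r) ^ 3)⁻¹)]
  have h : Integrable fun x : ℝ => ((1 + ‖x‖) ^ 3)⁻¹ := by
    simp_rw [one_add_norm_pow_inv_eq_rpow]
    exact integrable_one_add_norm (by simp)
  refine h.integrableOn.congr_fun (fun r hr => ?_) measurableSet_Ioi
  have hr : 0 < r := hr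
  simp [abs_of_pos hr, hr.ne']

theorem integral_fourier_smul_eq_smul_fourier {f g : V2 → ℂ} (hf : Integrable f)
    (hg : Integrable g) : ∫ x, 𝓕 f x • g x = ∫ x, f x • 𝓕 g x := by
  have := VectorFourier.integral_fourierIntegral_smul_eq_flip (L := innerₗ V2)
    Real.continuous_fourierChar continuous_inner hf hg
  rwa [flip_innerₗ] at this

/-- The Fourier integral of a function in `L¹ ∩ L²` is in `L²`. -/
theorem memLp_two_fourier {q : V2 → ℂ} (h1 : Integrable q) (h2 : MemLp q 2) :
    MemLp (𝓕 q) 2 := by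
  have hcont : Continuous (𝓕 q) :=
    VectorFourier.fourierIntegral_continuous Real.continuous_fourierChar
      (by exact continuous_inner) h1
  set U : Lp ℂ 2 (volume : Measure V2) := 𝓕 (h2.toLp q)
  have key : ∀ φ : 𝓢(V2, ℂ), ∫ x, φ x • U x = ∫ x, φ x • 𝓕 q x := by
    intro φ
    have := congrArg (fun T => T φ) (Lp.fourier_toTemperedDistribution_eq (h2.toLp q))
    simp only [TemperedDistribution.fourier_apply, Lp.toTemperedDistribution_apply] at this
    rw [← this]
    have h3 : ∫ x, (𝓕 φ) x • (h2.toLp q) x = ∫ x, (𝓕 φ) x • q x := by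
      apply integral_congr_ae
      filter_upwards [h2.coeFn_toLp] with x hx
      rw [hx]
    rw [h3]
    exact integral_fourier_smul_eq_smul_fourier φ.integrable h1
  have hae : (U : V2 → ℂ) =ᵐ[volume] 𝓕 q := by
    apply ae_eq_of_integral_contDiff_smul_eq
    · exact (Lp.memLp U).locallyIntegrable (by norm_num)
    · exact hcont.locallyIntegrable
    · intro g g_smooth g_cpt
      have hg₁ : HasCompactSupport (Complex.ofRealCLM ∘ g) := g_cpt.comp_left rfl
      have hg₂ : ContDiff ℝ ((⊤ : ℕ∞) : WithTop ℕ∞) (Complex.ofRealCLM ∘ g) := by fun_prop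
      simpa using key (hg₁.toSchwartzMap hg₂)
  exact (memLp_congr_ae hae).1 (Lp.memLp U)

theorem inner_e2 (x : V2) (i : Fin 2) : ⟪x, e2 i⟫ = x i := by
  simp [e2, EuclideanSpace.inner_single_right]

theorem abs_apply_le_norm (x : V2) (i : Fin 2) : |x i| ≤ ‖x‖ := by
  simpa using PiLp.norm_apply_le x i

/-- Complexification of a real-valued Schwartz function. -/
def schwartzOfReal (f : 𝓢(V2, ℝ)) : 𝓢(V2, ℂ) := f.postcompCLM Complex.ofRealCLM

@[simp]
theorem schwartzOfReal_apply (f : 𝓢(V2, ℝ)) (x : V2) : schwartzOfReal f x = (f x : ℂ) := rfl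

theorem lineDerivOp_schwartzOfReal_apply (b : 𝓢(V2, ℝ)) (e y : V2) :
    (∂_{e} (schwartzOfReal b)) y = ((fderiv ℝ b y e : ℝ) : ℂ) := by
  rw [lineDerivOp_apply_eq_fderiv]
  have : HasFDerivAt (schwartzOfReal b) _ y :=
    Complex.ofRealCLM.hasFDerivAt.comp y (b.differentiableAt (x := y)).hasFDerivAt
  rw [this.fderiv]
  rfl

/-- The symbol of the derivative in direction `e` of the Fourier integral of `g`. -/
def derivSymbol (g : V2 → ℂ) (e ξ : V2) : ℂ := -(2 * Real.pi * Complex.I) * ⟪ξ, e⟫ * g ξ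

theorem differentiableAt_re_fourier_and_fderiv {g : V2 → ℂ} (h0 : Integrable g)
    (h1 : Integrable fun ξ => ‖ξ‖ * ‖g ξ‖) (y : V2) :
    DifferentiableAt ℝ (fun y => (𝓕 g y).re) y ∧
      ∀ e, fderiv ℝ (fun y => (𝓕 g y).re) y e = (𝓕 (derivSymbol g e) y).re := by
  have h := Real.hasFDerivAt_fourier h0 h1 y
  have hre := Complex.reCLM.hasFDerivAt.comp y h
  refine ⟨hre.differentiableAt, fun e => ?_⟩
  have hint : Integrable (VectorFourier.fourierSMulRight (innerSL ℝ) g) := by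
    refine ((h1.const_mul (2 * Real.pi * ‖innerSL ℝ (E := V2)‖))).mono'
      (h0.aestronglyMeasurable.fourierSMulRight (L := innerSL ℝ)) (.of_forall fun ξ => ?_)
    refine (VectorFourier.norm_fourierSMulRight_le _ _ _).trans_eq (by ring)
  have h2 : fderiv ℝ (fun y => (𝓕 g y).re) y = _ := hre.fderiv
  rw [h2]
  simp only [ContinuousLinearMap.comp_apply, Complex.reCLM_apply]
  congr 1
  rw [Real.fourier_eq, Real.fourier_eq, ContinuousLinearMap.integral_apply]
  · refine integral_congr_ae (.of_forall fun ξ => ?_)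
    simp [derivSymbol, VectorFourier.fourierSMulRight_apply, Circle.smul_def,
      innerSL_apply_apply ℝ]
    ring
  · exact (Real.fourierIntegral_convergent_iff y).2 hint

theorem integral_re_mul_ofReal {f : V2 → ℂ} {b : V2 → ℝ} (h : Integrable fun y => f y * b y) :
    ∫ y, (f y).re * b y = (∫ y, f y * b y).re := by
  rw [← RCLike.re_eq_complex_re, ← integral_re h]
  simp

theorem integrable_derivSymbol {g : V2 → ℂ} (h0 : Integrable g)
    (h1 : Integrable fun ξ => ‖ξ‖ * ‖g ξ‖) (e : V2) : Integrable (derivSymbol g e) := by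
  refine (h1.const_mul (2 * Real.pi * ‖e‖)).mono' ?_ (.of_forall fun ξ => ?_)
  · unfold derivSymbol
    have : AEStronglyMeasurable (fun ξ : V2 => -(2 * Real.pi * Complex.I) * (⟪ξ, e⟫ : ℂ)) volume :=
      Continuous.aestronglyMeasurable (by fun_prop)
    exact this.mul h0.aestronglyMeasurable
  · simp only [derivSymbol, norm_mul, norm_neg, Complex.norm_I, Complex.norm_real, mul_one,
      Complex.norm_ofNat, Real.norm_eq_abs, abs_of_pos Real.pi_pos]
    have := abs_real_inner_le_norm ξ e
    calc 2 * Real.pi * |⟪ξ, e⟫| * ‖g ξ‖ ≤ 2 * Real.pi * (‖ξ‖ * ‖e‖) * ‖g ξ‖ := by gcongr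
      _ = _ := by ring

/-- Parseval's identity for directional derivatives. -/
theorem integral_re_fourier_derivSymbol_mul {g : V2 → ℂ} (h0 : Integrable g)
    (h1 : Integrable fun ξ => ‖ξ‖ * ‖g ξ‖) (b : 𝓢(V2, ℝ)) (e : V2) :
    Integrable (fun ξ => 4 * Real.pi ^ 2 * (⟪ξ, e⟫ : ℂ) ^ 2 * g ξ * 𝓕 (schwartzOfReal b) ξ) ∧
    ∫ y, (𝓕 (derivSymbol g e) y).re * fderiv ℝ b y e =
      (∫ ξ, 4 * Real.pi ^ 2 * (⟪ξ, e⟫ : ℂ) ^ 2 * g ξ * 𝓕 (schwartzOfReal b) ξ).re := by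
  have hq := integrable_derivSymbol h0 h1 e
  have hb := lineDerivOp_schwartzOfReal_apply b e
  have hpt : ∀ ξ, derivSymbol g e ξ • 𝓕 (∂_{e} (schwartzOfReal b)) ξ =
      4 * Real.pi ^ 2 * (⟪ξ, e⟫ : ℂ) ^ 2 * g ξ * 𝓕 (schwartzOfReal b) ξ := by
    intro ξ
    have : (inner ℝ · e : V2 → ℝ).HasTemperateGrowth := by fun_prop
    rw [fourier_lineDerivOp_eq]
    simp [this, derivSymbol]
    linear_combination (-4 * Real.pi ^ 2 * (⟪ξ, e⟫ : ℂ) ^ 2 * g ξ * 𝓕 (schwartzOfReal b) ξ) *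
      Complex.I_sq
  have hbd : Continuous (𝓕 (derivSymbol g e)) :=
    VectorFourier.fourierIntegral_continuous Real.continuous_fourierChar
      (by exact continuous_inner) hq
  constructor
  · simp_rw [← hpt]
    exact hq.mul_bdd (𝓕 (∂_{e} (schwartzOfReal b))).continuous.aestronglyMeasurable
      (.of_forall fun ξ => norm_le_seminorm ℝ _ ξ)
  · simp_rw [← hpt]
    rw [integral_re_mul_ofReal]
    · simp_rw [← hb]
      have := integral_fourier_smul_eq_smul_fourier hq (∂_{e} (schwartzOfReal b)).integrable
      simp only [smul_eq_mul] at this ⊢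
      rw [this]
      rfl
    · simp_rw [← hb]
      exact ((∂_{e} (schwartzOfReal b)).integrable).bdd_mul hbd.aestronglyMeasurable
        (.of_forall fun ξ => VectorFourier.norm_fourierIntegral_le_integral_norm _ _ _ _ ξ)

section Soliton

variable (ρ : 𝓢(V2, ℝ)) (v : V2) (ω : ℝ)

/-- The Schwartz function `x ↦ x_l ρ(x)`. -/
def coordMul (l : Fin 2) : 𝓢(V2, ℂ) :=
  smulLeftCLM ℂ (inner ℝ · (e2 l) : V2 → ℝ) (schwartzOfReal ρ)

theorem coordMul_apply (l : Fin 2) (x : V2) : coordMul ρ l x = ((x l * ρ x : ℝ) : ℂ) := by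
  have : (inner ℝ · (e2 l) : V2 → ℝ).HasTemperateGrowth := by fun_prop
  rw [coordMul, smulLeftCLM_apply_apply this, inner_e2]
  simp

/-- The components of `Jx ρ(x)`. -/
def rotMul (j : Fin 2) : 𝓢(V2, ℂ) := ![coordMul ρ 1, -coordMul ρ 0] j

/-- The source of the soliton field on the Fourier side. -/
def solNum (j : Fin 2) (ξ : V2) : ℂ :=
  ((v j - ξ j * ⟪v, ξ⟫ / ‖ξ‖ ^ 2 : ℝ) : ℂ) * 𝓕⁻ (schwartzOfReal ρ) ξ
    - ω * 𝓕⁻ (rotMul ρ j) ξ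

/-- The function whose Fourier integral, in Mathlib's normalization, is the soliton field. -/
def solSymbol (j : Fin 2) (ξ : V2) : ℂ :=
  solNum ρ v ω j ξ / ((4 * Real.pi ^ 2 * Dv v ξ : ℝ) : ℂ)

theorem fourierInv_eq_integral_exp (f : 𝓢(V2, ℂ)) (k : V2) :
    𝓕⁻ f (-(2 * Real.pi)⁻¹ • k) = ∫ x, Complex.exp (-Complex.I * (⟪k, x⟫ : ℂ)) * f x := by
  rw [fourierInv_coe, Real.fourierInv_eq']
  refine integral_congr_ae (.of_forall fun x => ?_)
  simp only [smul_eq_mul]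
  congr 2
  rw [inner_smul_right, real_inner_comm x k]
  push_cast
  have : (Real.pi : ℂ) ≠ 0 := by exact_mod_cast Real.pi_ne_zero
  field_simp

theorem FT_eq_fourierInv (k : V2) :
    FT ρ k = ((2 * Real.pi : ℝ) : ℂ)⁻¹ * 𝓕⁻ (schwartzOfReal ρ) (-(2 * Real.pi)⁻¹ • k) := by
  rw [fourierInv_eq_integral_exp]
  rfl

theorem pd_FT (l : Fin 2) (k : V2) :
    pd (FT ρ) l k = -Complex.I * ((2 * Real.pi : ℝ) : ℂ)⁻¹ *
      𝓕⁻ (coordMul ρ l) (-(2 * Real.pi)⁻¹ • k) := by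
  have hlin : HasFDerivAt (fun k : V2 => -(2 * Real.pi)⁻¹ • k)
      (-(2 * Real.pi)⁻¹ • ContinuousLinearMap.id ℝ V2) k :=
    (-(2 * Real.pi)⁻¹ • ContinuousLinearMap.id ℝ V2).hasFDerivAt
  have h := (((𝓕⁻ (schwartzOfReal ρ)).differentiableAt
    (x := -(2 * Real.pi)⁻¹ • k)).hasFDerivAt.comp k hlin).const_mul ((2 * Real.pi : ℝ) : ℂ)⁻¹
  have hd := (h.congr_of_eventuallyEq (f₁ := FT ρ) (.of_forall (FT_eq_fourierInv ρ))).fderiv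
  rw [pd, hd]
  have h2 : fderiv ℝ ⇑(𝓕⁻ (schwartzOfReal ρ) : 𝓢(V2, ℂ)) (-(2 * Real.pi)⁻¹ • k) (e2 l) =
      2 * Real.pi * Complex.I * 𝓕⁻ (coordMul ρ l) (-(2 * Real.pi)⁻¹ • k) := by
    rw [← lineDerivOp_apply_eq_fderiv, lineDerivOp_fourierInv_eq, FourierTransform.fourierInv_smul]
    rfl
  have : (Real.pi : ℂ) ≠ 0 := by exact_mod_cast Real.pi_ne_zero
  simp only [smul_apply, ContinuousLinearMap.comp_apply, map_smul,
    ContinuousLinearMap.id_apply, h2]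
  simp only [smul_eq_mul, Complex.real_smul]
  push_cast
  field_simp

theorem Ahat_eq_solSymbol (j : Fin 2) (k : V2) :
    2 * Real.pi * Ahat ρ v ω j k = solSymbol ρ v ω j (-(2 * Real.pi)⁻¹ • k) := by
  have hpi : (Real.pi : ℂ) ≠ 0 := by exact_mod_cast Real.pi_ne_zero
  have hD : 4 * Real.pi ^ 2 * Dv v (-(2 * Real.pi)⁻¹ • k) = Dv v k := by
    simp only [Dv, norm_smul, inner_smul_right, Real.norm_eq_abs, mul_pow, sq_abs]
    field_simp
    ring
  have hdir : (-(2 * Real.pi)⁻¹ • k) j * ⟪v, -(2 * Real.pi)⁻¹ • k⟫ / ‖-(2 * Real.pi)⁻¹ • k‖ ^ 2 =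
      k j * ⟪v, k⟫ / ‖k‖ ^ 2 := by
    simp only [norm_smul, inner_smul_right, Real.norm_eq_abs, mul_pow, sq_abs, PiLp.smul_apply,
      smul_eq_mul]
    field_simp
  have hJ : 2 * Real.pi * (Complex.I * ω * Jgrad (FT ρ) j k) =
      ω * 𝓕⁻ (rotMul ρ j) (-(2 * Real.pi)⁻¹ • k) := by
    have hneg : 𝓕⁻ (-coordMul ρ 0) = -𝓕⁻ (coordMul ρ 0) :=
      FourierTransform.fourierInv_neg _
    fin_cases j
    · simp only [Jgrad, rotMul, pd_FT]
      generalize -(2 * Real.pi)⁻¹ • k = ξ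
      simp
      field_simp
      linear_combination (-(ω : ℂ) * (𝓕⁻ (coordMul ρ 1) ξ)) * Complex.I_sq
    · simp only [Jgrad, rotMul, pd_FT]
      generalize -(2 * Real.pi)⁻¹ • k = ξ
      simp [hneg]
      field_simp
      linear_combination (ω : ℂ) * (𝓕⁻ (coordMul ρ 0) ξ) * Complex.I_sq
  rw [solSymbol, solNum, hD, hdir, ← hJ, Ahat, FT_eq_fourierInv, mul_div_assoc']
  congr 1
  push_cast
  field_simp

theorem Asol_eq_re_fourier (j : Fin 2) :
    Asol ρ v ω j = fun y => (𝓕 (solSymbol ρ v ω j) y).re := by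
  funext y
  rw [Asol, Real.fourier_eq']
  congr 1
  set Φ : V2 → ℂ := fun ξ =>
    Complex.exp ((-2 * Real.pi * ⟪ξ, y⟫ : ℝ) * Complex.I) • solSymbol ρ v ω j ξ with hΦ
  have hpi : (Real.pi : ℂ) ≠ 0 := by exact_mod_cast Real.pi_ne_zero
  have h := Measure.integral_comp_smul (volume : Measure V2) Φ (-(2 * Real.pi)⁻¹)
  have h2 : ∀ k, Φ (-(2 * Real.pi)⁻¹ • k) =
      2 * Real.pi * (Complex.exp (Complex.I * (⟪k, y⟫ : ℂ)) * Ahat ρ v ω j k) := by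
    intro k
    rw [hΦ]
    simp only [smul_eq_mul, inner_smul_left]
    rw [← Ahat_eq_solSymbol]
    have : ((-2 * Real.pi * ((starRingEnd ℝ) (-(2 * Real.pi)⁻¹) * ⟪k, y⟫) : ℝ) : ℂ) * Complex.I
        = Complex.I * (⟪k, y⟫ : ℂ) := by
      simp
      field_simp
    rw [this]
    ring
  simp_rw [h2] at h
  rw [integral_const_mul] at h
  have hfin : Module.finrank ℝ V2 = 2 := by simp
  rw [hfin] at h
  have h3 : |((-(2 * Real.pi)⁻¹) ^ 2)⁻¹| = 4 * Real.pi ^ 2 := by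
    rw [abs_of_nonneg (by positivity)]
    field_simp
    ring
  rw [h3, Complex.real_smul] at h
  push_cast at h ⊢
  trans ∫ ξ, Φ ξ
  swap
  · simp [hΦ]
  field_simp
  refine mul_left_cancel₀ (mul_ne_zero two_ne_zero hpi) ?_
  linear_combination h

theorem integral_coord_mul_eq_zero {f : V2 → ℝ} (hf : ∀ x, f (-x) = f x) (l : Fin 2) :
    ∫ x : V2, x l * f x = 0 := by
  have h : ∫ x : V2, x l * f x = -∫ x : V2, x l * f x := by
    conv_lhs => rw [← integral_neg_eq_self]
    rw [← integral_neg]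
    simp [hf]
  linarith

theorem fourierInv_apply_zero (f : 𝓢(V2, ℂ)) : 𝓕⁻ f 0 = ∫ x, f x := by
  rw [fourierInv_coe, Real.fourierInv_eq']
  simp

variable {ρ}

theorem fourierInv_schwartzOfReal_zero (hneu : ∫ x, ρ x = 0) :
    𝓕⁻ (schwartzOfReal ρ) 0 = 0 := by
  rw [fourierInv_apply_zero]
  simp_rw [schwartzOfReal_apply]
  rw [integral_complex_ofReal, hneu, Complex.ofReal_zero]

theorem fourierInv_rotMul_zero (hrad : ∀ x y : V2, ‖x‖ = ‖y‖ → ρ x = ρ y) (j : Fin 2) :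
    𝓕⁻ (rotMul ρ j) 0 = 0 := by
  have h : ∀ l, ∫ x, coordMul ρ l x = 0 := by
    intro l
    simp_rw [coordMul_apply]
    rw [integral_complex_ofReal, integral_coord_mul_eq_zero (fun x => hrad _ _ (norm_neg x)),
      Complex.ofReal_zero]
  rw [fourierInv_apply_zero]
  fin_cases j
  · exact h 1
  · simp [rotMul, integral_neg, h 0]

theorem measurable_solSymbol (j : Fin 2) : Measurable (solSymbol ρ v ω j) := by
  have h1 : Measurable (𝓕⁻ (schwartzOfReal ρ) : 𝓢(V2, ℂ)) := (SchwartzMap.continuous _).measurable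
  have h2 : Measurable (𝓕⁻ (rotMul ρ j) : 𝓢(V2, ℂ)) := (SchwartzMap.continuous _).measurable
  unfold solSymbol solNum Dv
  fun_prop

theorem solNum_zero (hrad : ∀ x y : V2, ‖x‖ = ‖y‖ → ρ x = ρ y) (hneu : ∫ x, ρ x = 0)
    (j : Fin 2) : solNum ρ v ω j 0 = 0 := by
  simp [solNum, fourierInv_schwartzOfReal_zero hneu, fourierInv_rotMul_zero hrad]

variable {v}

theorem le_Dv (v ξ : V2) : (1 - ‖v‖ ^ 2) * ‖ξ‖ ^ 2 ≤ Dv v ξ := by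
  have := abs_real_inner_le_norm v ξ
  have h2 : ⟪v, ξ⟫ ^ 2 ≤ (‖v‖ * ‖ξ‖) ^ 2 := sq_le_sq' (by linarith [neg_abs_le ⟪v, ξ⟫]) (by
    linarith [le_abs_self ⟪v, ξ⟫])
  unfold Dv
  nlinarith

theorem Dv_pos (hv : ‖v‖ < 1) {ξ : V2} (hξ : ξ ≠ 0) : 0 < Dv v ξ := by
  have h1 : 0 < 1 - ‖v‖ ^ 2 := by nlinarith [norm_nonneg v]
  have h2 : 0 < ‖ξ‖ := norm_pos_iff.2 hξ
  exact lt_of_lt_of_le (by positivity) (le_Dv v ξ)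

theorem four_pi_sq_Dv_mul_solSymbol (hrad : ∀ x y : V2, ‖x‖ = ‖y‖ → ρ x = ρ y)
    (hneu : ∫ x, ρ x = 0) (hv : ‖v‖ < 1) (j : Fin 2) (ξ : V2) :
    4 * Real.pi ^ 2 * (Dv v ξ : ℂ) * solSymbol ρ v ω j ξ = solNum ρ v ω j ξ := by
  rcases eq_or_ne ξ 0 with rfl | hξ
  · simp [Dv, solNum_zero v ω hrad hneu]
  · have h1 : (Dv v ξ : ℂ) ≠ 0 := by exact_mod_cast (Dv_pos hv hξ).ne'
    have hpi : (Real.pi : ℂ) ≠ 0 := by exact_mod_cast Real.pi_ne_zero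
    rw [solSymbol]
    push_cast
    field_simp

theorem exists_norm_solSymbol_le (hrad : ∀ x y : V2, ‖x‖ = ‖y‖ → ρ x = ρ y)
    (hneu : ∫ x, ρ x = 0) (hv : ‖v‖ < 1) (j : Fin 2) :
    ∃ C, ∀ ξ, ‖solSymbol ρ v ω j ξ‖ ≤ C * (‖ξ‖⁻¹ * ((1 + ‖ξ‖) ^ 3)⁻¹) := by
  obtain ⟨C₁, hC₁, h₁⟩ := SchwartzMap.exists_norm_le_of_apply_zero _
    (fourierInv_schwartzOfReal_zero hneu)
  obtain ⟨C₂, hC₂, h₂⟩ := SchwartzMap.exists_norm_le_of_apply_zero _ (fourierInv_rotMul_zero hrad j)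
  have hd : 0 < 1 - ‖v‖ ^ 2 := by nlinarith [norm_nonneg v]
  refine ⟨(2 * C₁ + |ω| * C₂) / (4 * Real.pi ^ 2 * (1 - ‖v‖ ^ 2)), fun ξ => ?_⟩
  rcases eq_or_ne ξ 0 with rfl | hξ
  · simp [solSymbol, Dv]
  have hξ0 : 0 < ‖ξ‖ := norm_pos_iff.2 hξ
  have hdir : |v j - ξ j * ⟪v, ξ⟫ / ‖ξ‖ ^ 2| ≤ 2 := by
    have e1 : |ξ j * ⟪v, ξ⟫ / ‖ξ‖ ^ 2| ≤ 1 := by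
      rw [abs_div, abs_mul, abs_of_pos (pow_pos hξ0 2), div_le_one (by positivity)]
      calc |ξ j| * |⟪v, ξ⟫| ≤ ‖ξ‖ * (‖v‖ * ‖ξ‖) := by
            gcongr
            · exact abs_apply_le_norm ξ j
            · exact abs_real_inner_le_norm v ξ
        _ ≤ ‖ξ‖ * (1 * ‖ξ‖) := by gcongr
        _ = ‖ξ‖ ^ 2 := by ring
    have e2 := abs_apply_le_norm v j
    have e3 := abs_sub (v j) (ξ j * ⟪v, ξ⟫ / ‖ξ‖ ^ 2)
    linarith
  have hnum : ‖solNum ρ v ω j ξ‖ ≤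
      (2 * C₁ + |ω| * C₂) * (‖ξ‖ * ((1 + ‖ξ‖) ^ 3)⁻¹) := by
    refine (norm_sub_le _ _).trans ?_
    rw [norm_mul, norm_mul, Complex.norm_real, Complex.norm_real, Real.norm_eq_abs,
      Real.norm_eq_abs]
    calc _ ≤ 2 * (C₁ * (‖ξ‖ * ((1 + ‖ξ‖) ^ 3)⁻¹)) + |ω| * (C₂ * (‖ξ‖ * ((1 + ‖ξ‖) ^ 3)⁻¹)) := by
          gcongr
          · exact h₁ ξ
          · exact h₂ ξ
      _ = _ := by ring
  rw [solSymbol, norm_div, Complex.norm_real, Real.norm_eq_abs,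
    abs_of_pos (by have := Dv_pos hv hξ; positivity)]
  calc _ ≤ (2 * C₁ + |ω| * C₂) * (‖ξ‖ * ((1 + ‖ξ‖) ^ 3)⁻¹) /
        (4 * Real.pi ^ 2 * ((1 - ‖v‖ ^ 2) * ‖ξ‖ ^ 2)) := by
        gcongr
        exact le_Dv v ξ
    _ = _ := by field_simp

theorem integrable_solSymbol (hrad : ∀ x y : V2, ‖x‖ = ‖y‖ → ρ x = ρ y)
    (hneu : ∫ x, ρ x = 0) (hv : ‖v‖ < 1) (j : Fin 2) : Integrable (solSymbol ρ v ω j) := by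
  obtain ⟨C, hC⟩ := exists_norm_solSymbol_le ω hrad hneu hv j
  exact (integrable_norm_inv_mul_one_add_norm_cube_inv.const_mul C).mono'
    (measurable_solSymbol v ω j).aestronglyMeasurable (.of_forall hC)

theorem exists_norm_mul_norm_solSymbol_le (hrad : ∀ x y : V2, ‖x‖ = ‖y‖ → ρ x = ρ y)
    (hneu : ∫ x, ρ x = 0) (hv : ‖v‖ < 1) (j : Fin 2) :
    ∃ C, ∀ ξ, ‖ξ‖ * ‖solSymbol ρ v ω j ξ‖ ≤ C * ((1 + ‖ξ‖) ^ 3)⁻¹ := by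
  obtain ⟨C, hC⟩ := exists_norm_solSymbol_le ω hrad hneu hv j
  refine ⟨|C|, fun ξ => ?_⟩
  rcases eq_or_ne ξ 0 with rfl | hξ
  · simp
  have hξ0 : 0 < ‖ξ‖ := norm_pos_iff.2 hξ
  calc _ ≤ ‖ξ‖ * (C * (‖ξ‖⁻¹ * ((1 + ‖ξ‖) ^ 3)⁻¹)) := by gcongr; exact hC ξ
    _ = C * ((1 + ‖ξ‖) ^ 3)⁻¹ := by field_simp
    _ ≤ _ := by gcongr; exact le_abs_self C

theorem integrable_norm_mul_solSymbol (hrad : ∀ x y : V2, ‖x‖ = ‖y‖ → ρ x = ρ y)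
    (hneu : ∫ x, ρ x = 0) (hv : ‖v‖ < 1) (j : Fin 2) :
    Integrable fun ξ => ‖ξ‖ * ‖solSymbol ρ v ω j ξ‖ := by
  obtain ⟨C, hC⟩ := exists_norm_mul_norm_solSymbol_le ω hrad hneu hv j
  refine (integrable_one_add_norm_cube_inv.const_mul C).mono'
    (measurable_norm.mul (measurable_solSymbol v ω j).norm).aestronglyMeasurable
    (.of_forall fun ξ => ?_)
  rw [Real.norm_of_nonneg (by positivity)]
  exact hC ξ

theorem memLp_derivSymbol_solSymbol (hrad : ∀ x y : V2, ‖x‖ = ‖y‖ → ρ x = ρ y)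
    (hneu : ∫ x, ρ x = 0) (hv : ‖v‖ < 1) (j : Fin 2) (e : V2) :
    MemLp (derivSymbol (solSymbol ρ v ω j) e) 2 := by
  obtain ⟨C, hC⟩ := exists_norm_mul_norm_solSymbol_le ω hrad hneu hv j
  have hint := integrable_derivSymbol (integrable_solSymbol ω hrad hneu hv j)
    (integrable_norm_mul_solSymbol ω hrad hneu hv j) e
  have hbdd : ∀ ξ, ‖derivSymbol (solSymbol ρ v ω j) e ξ‖ ≤ 2 * Real.pi * ‖e‖ * |C| := by
    intro ξ
    simp only [derivSymbol, norm_mul, norm_neg, Complex.norm_I, Complex.norm_real, mul_one,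
      Complex.norm_ofNat, Real.norm_eq_abs, abs_of_pos Real.pi_pos]
    have h1 := abs_real_inner_le_norm ξ e
    have h2 : ((1 + ‖ξ‖) ^ 3)⁻¹ ≤ 1 :=
      inv_le_one_of_one_le₀ (one_le_pow₀ (by linarith [norm_nonneg ξ]))
    have h3 : C * ((1 + ‖ξ‖) ^ 3)⁻¹ ≤ |C| * 1 :=
      mul_le_mul (le_abs_self C) h2 (by positivity) (abs_nonneg C)
    calc _ ≤ 2 * Real.pi * (‖ξ‖ * ‖e‖) * ‖solSymbol ρ v ω j ξ‖ := by gcongr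
      _ = 2 * Real.pi * ‖e‖ * (‖ξ‖ * ‖solSymbol ρ v ω j ξ‖) := by ring
      _ ≤ 2 * Real.pi * ‖e‖ * (|C| * 1) :=
        mul_le_mul_of_nonneg_left ((hC ξ).trans h3) (by positivity)
      _ = _ := by ring
  rw [memLp_two_iff_integrable_sq_norm hint.aestronglyMeasurable]
  refine (hint.norm.const_mul (2 * Real.pi * ‖e‖ * |C|)).mono'
    (hint.aestronglyMeasurable.norm.pow 2) (.of_forall fun ξ => ?_)
  rw [Real.norm_of_nonneg (by positivity), sq]
  exact mul_le_mul_of_nonneg_right (hbdd ξ) (norm_nonneg _)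

theorem differentiableAt_Asol (hrad : ∀ x y : V2, ‖x‖ = ‖y‖ → ρ x = ρ y)
    (hneu : ∫ x, ρ x = 0) (hv : ‖v‖ < 1) (j : Fin 2) (y : V2) :
    DifferentiableAt ℝ (Asol ρ v ω j) y := by
  rw [Asol_eq_re_fourier]
  exact (differentiableAt_re_fourier_and_fderiv (integrable_solSymbol ω hrad hneu hv j)
    (integrable_norm_mul_solSymbol ω hrad hneu hv j) y).1

theorem fderiv_Asol (hrad : ∀ x y : V2, ‖x‖ = ‖y‖ → ρ x = ρ y)
    (hneu : ∫ x, ρ x = 0) (hv : ‖v‖ < 1) (j : Fin 2) (y e : V2) :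
    fderiv ℝ (Asol ρ v ω j) y e = (𝓕 (derivSymbol (solSymbol ρ v ω j) e) y).re := by
  rw [Asol_eq_re_fourier]
  exact (differentiableAt_re_fourier_and_fderiv (integrable_solSymbol ω hrad hneu hv j)
    (integrable_norm_mul_solSymbol ω hrad hneu hv j) y).2 e

theorem memLp_fderiv_Asol (hrad : ∀ x y : V2, ‖x‖ = ‖y‖ → ρ x = ρ y)
    (hneu : ∫ x, ρ x = 0) (hv : ‖v‖ < 1) (j : Fin 2) (e : V2) :
    MemLp (fun y => fderiv ℝ (Asol ρ v ω j) y e) 2 := by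
  simp_rw [fderiv_Asol ω hrad hneu hv]
  exact (memLp_two_fourier (integrable_derivSymbol (integrable_solSymbol ω hrad hneu hv j)
    (integrable_norm_mul_solSymbol ω hrad hneu hv j) e)
    (memLp_derivSymbol_solSymbol ω hrad hneu hv j e)).re

theorem integrable_mul_Asol (hrad : ∀ x y : V2, ‖x‖ = ‖y‖ → ρ x = ρ y)
    (hneu : ∫ x, ρ x = 0) (hv : ‖v‖ < 1) (j : Fin 2) {f : V2 → ℝ} (hf : Integrable f) :
    Integrable fun y => f y * Asol ρ v ω j y := by
  refine hf.mul_bdd (c := ∫ ξ, ‖solSymbol ρ v ω j ξ‖)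
    (continuous_iff_continuousAt.2 fun y =>
      (differentiableAt_Asol ω hrad hneu hv j y).continuousAt).aestronglyMeasurable
    (.of_forall fun y => ?_)
  rw [Asol_eq_re_fourier]
  exact (Complex.abs_re_le_norm _).trans
    (VectorFourier.norm_fourierIntegral_le_integral_norm _ _ _ _ y)

theorem integrable_coord_mul (ρ : 𝓢(V2, ℝ)) (l : Fin 2) : Integrable fun y : V2 => y l * ρ y := by
  simpa [coordMul_apply] using (coordMul ρ l).integrable.re

/-- The weak form of the soliton equation in a single component. -/
theorem integral_fderiv_Asol_mul_fderiv (hrad : ∀ x y : V2, ‖x‖ = ‖y‖ → ρ x = ρ y)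
    (hneu : ∫ x, ρ x = 0) (hv : ‖v‖ < 1) (j : Fin 2) (b : 𝓢(V2, ℝ)) :
    Integrable (fun ξ => solNum ρ v ω j ξ * 𝓕 (schwartzOfReal b) ξ) ∧
    ∑ i, (∫ y, fderiv ℝ (Asol ρ v ω j) y (e2 i) * fderiv ℝ b y (e2 i)) -
      ∫ y, fderiv ℝ (Asol ρ v ω j) y v * fderiv ℝ b y v =
      (∫ ξ, solNum ρ v ω j ξ * 𝓕 (schwartzOfReal b) ξ).re := by
  have key := integral_re_fourier_derivSymbol_mul (integrable_solSymbol ω hrad hneu hv j)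
    (integrable_norm_mul_solSymbol ω hrad hneu hv j) b
  have hpt : ∀ ξ, solNum ρ v ω j ξ * 𝓕 (schwartzOfReal b) ξ =
      4 * Real.pi ^ 2 * (⟪ξ, e2 0⟫ : ℂ) ^ 2 * solSymbol ρ v ω j ξ * 𝓕 (schwartzOfReal b) ξ +
      4 * Real.pi ^ 2 * (⟪ξ, e2 1⟫ : ℂ) ^ 2 * solSymbol ρ v ω j ξ * 𝓕 (schwartzOfReal b) ξ -
      4 * Real.pi ^ 2 * (⟪ξ, v⟫ : ℂ) ^ 2 * solSymbol ρ v ω j ξ * 𝓕 (schwartzOfReal b) ξ := by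
    intro ξ
    rw [← four_pi_sq_Dv_mul_solSymbol ω hrad hneu hv, Dv, EuclideanSpace.real_norm_sq_eq,
      Fin.sum_univ_two, inner_e2, inner_e2, real_inner_comm]
    push_cast
    ring
  simp_rw [hpt, fderiv_Asol ω hrad hneu hv]
  refine ⟨((key _).1.add (key _).1).sub (key _).1, ?_⟩
  rw [integral_sub ((key _).1.fun_add (key _).1) (key _).1, integral_add (key _).1 (key _).1,
    Fin.sum_univ_two, (key _).2, (key _).2, (key _).2, Complex.sub_re, Complex.add_re]

theorem sum_apply_mul_fourier_eq_zero {a : Fin 2 → 𝓢(V2, ℝ)}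
    (hdiv : ∀ y : V2, ∑ j, fderiv ℝ (a j) y (e2 j) = 0) (ξ : V2) :
    ∑ j, (ξ j : ℂ) * 𝓕 (schwartzOfReal (a j)) ξ = 0 := by
  have h0 : ∂_{e2 0} (schwartzOfReal (a 0)) + ∂_{e2 1} (schwartzOfReal (a 1)) = 0 := by
    ext y
    have := hdiv y
    rw [Fin.sum_univ_two] at this
    rw [add_apply, lineDerivOp_schwartzOfReal_apply,
      lineDerivOp_schwartzOfReal_apply, ← Complex.ofReal_add, this]
    rfl
  have h1 : ∀ l, 𝓕 (∂_{e2 l} (schwartzOfReal (a l))) ξ =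
      2 * Real.pi * Complex.I * (ξ l * 𝓕 (schwartzOfReal (a l)) ξ) := by
    intro l
    have : (inner ℝ · (e2 l) : V2 → ℝ).HasTemperateGrowth := by fun_prop
    rw [fourier_lineDerivOp_eq]
    simp [this, ← inner_e2 ξ l]
  have h2 := congrArg (fun f => (𝓕 f : 𝓢(V2, ℂ)) ξ) h0
  simp only [FourierTransform.fourier_add, FourierTransform.fourier_zero, add_apply,
    h1, zero_apply] at h2
  rw [← mul_add] at h2
  rw [Fin.sum_univ_two]
  exact (mul_eq_zero.1 h2).resolve_left
    (mul_ne_zero (by exact_mod_cast Real.two_pi_pos.ne') Complex.I_ne_zero)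

theorem integral_fourierInv_mul_fourier (f g : 𝓢(V2, ℂ)) :
    ∫ ξ, 𝓕⁻ f ξ * 𝓕 g ξ = ∫ x, f x * g x := by
  have := integral_fourier_smul_eq_smul_fourier (𝓕⁻ f).integrable g.integrable
  rw [← SchwartzMap.fourier_coe, ← SchwartzMap.fourier_coe, fourier_fourierInv_eq] at this
  exact this.symm

/-- The weak form of the soliton equation, tested against solenoidal Schwartz fields. -/
theorem soliton_weak_equation (hrad : ∀ x y : V2, ‖x‖ = ‖y‖ → ρ x = ρ y)
    (hneu : ∫ x, ρ x = 0) (hv : ‖v‖ < 1) {a : Fin 2 → 𝓢(V2, ℝ)}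
    (hdiv : ∀ y : V2, ∑ j, fderiv ℝ (a j) y (e2 j) = 0) :
    ∑ j, (∑ i, (∫ y, fderiv ℝ (Asol ρ v ω j) y (e2 i) * fderiv ℝ (a j) y (e2 i)) -
      ∫ y, fderiv ℝ (Asol ρ v ω j) y v * fderiv ℝ (a j) y v) =
      ∑ j, v j * chargeTerm ρ (fun l => a l) j - ω * angTerm ρ (fun l => a l) := by
  have key := fun j => integral_fderiv_Asol_mul_fderiv ω hrad hneu hv j (a j)
  have hI : ∀ f g : 𝓢(V2, ℂ), Integrable fun ξ => 𝓕⁻ f ξ * 𝓕 g ξ := fun f g =>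
    (𝓕⁻ f).integrable.mul_bdd (𝓕 g).continuous.aestronglyMeasurable
      (.of_forall fun ξ => norm_le_seminorm ℝ _ ξ)
  have hpt : ∀ ξ, solNum ρ v ω 0 ξ * 𝓕 (schwartzOfReal (a 0)) ξ +
      solNum ρ v ω 1 ξ * 𝓕 (schwartzOfReal (a 1)) ξ =
      ((v 0 : ℂ) * (𝓕⁻ (schwartzOfReal ρ) ξ * 𝓕 (schwartzOfReal (a 0)) ξ) +
        (v 1 : ℂ) * (𝓕⁻ (schwartzOfReal ρ) ξ * 𝓕 (schwartzOfReal (a 1)) ξ)) -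
      (ω : ℂ) * (𝓕⁻ (rotMul ρ 0) ξ * 𝓕 (schwartzOfReal (a 0)) ξ +
        𝓕⁻ (rotMul ρ 1) ξ * 𝓕 (schwartzOfReal (a 1)) ξ) := by
    intro ξ
    have h := sum_apply_mul_fourier_eq_zero hdiv ξ
    rw [Fin.sum_univ_two] at h
    simp only [solNum]
    push_cast
    linear_combination (-(⟪v, ξ⟫ / ‖ξ‖ ^ 2 : ℂ) * 𝓕⁻ (schwartzOfReal ρ) ξ) * h
  rw [Fin.sum_univ_two, (key 0).2, (key 1).2, ← Complex.add_re,
    ← integral_add (key 0).1 (key 1).1]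
  simp_rw [hpt]
  rw [integral_sub (((hI _ _).const_mul _).fun_add ((hI _ _).const_mul _))
      (((hI _ _).fun_add (hI _ _)).const_mul _),
    integral_add ((hI _ _).const_mul _) ((hI _ _).const_mul _), integral_const_mul,
    integral_const_mul, integral_const_mul, integral_add (hI _ _) (hI _ _)]
  simp_rw [integral_fourierInv_mul_fourier]
  have hc : ∀ l, ∫ x, schwartzOfReal ρ x * schwartzOfReal (a l) x =
      ((chargeTerm ρ (fun l => a l) l : ℝ) : ℂ) := by
    intro l
    rw [chargeTerm, ← integral_complex_ofReal]
    simp [mul_comm]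
  have hI2 : ∀ f g : 𝓢(V2, ℂ), Integrable fun ξ => f ξ * g ξ := fun f g =>
    f.integrable.mul_bdd g.continuous.aestronglyMeasurable
      (.of_forall fun ξ => norm_le_seminorm ℝ _ ξ)
  have ha : (∫ x, rotMul ρ 0 x * schwartzOfReal (a 0) x) +
      ∫ x, rotMul ρ 1 x * schwartzOfReal (a 1) x = ((angTerm ρ (fun l => a l) : ℝ) : ℂ) := by
    rw [← integral_add (hI2 _ _) (hI2 _ _), angTerm, ← integral_complex_ofReal]
    refine integral_congr_ae (.of_forall fun x => ?_)
    simp [rotMul, coordMul_apply]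
    ring
  rw [hc, hc, ha]
  simp [Fin.sum_univ_two]

end Soliton

section FiniteEnergy

/-- Differentiable vector fields with square-integrable gradient. -/
structure HasSqIntegrableGrad (A : Fin 2 → V2 → ℝ) : Prop where
  differentiable : ∀ j, Differentiable ℝ (A j)
  memLp_fderiv : ∀ j e, MemLp (fun y => fderiv ℝ (A j) y e) 2

theorem SchwartzMap.hasSqIntegrableGrad (a : Fin 2 → 𝓢(V2, ℝ)) :
    HasSqIntegrableGrad fun j => a j where
  differentiable j := (a j).differentiable
  memLp_fderiv j e := (∂_{e} (a j)).memLp 2 volume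

theorem MeasureTheory.MemLp.integrable_mul_two {f g : V2 → ℝ} (hf : MemLp f 2) (hg : MemLp g 2) :
    Integrable fun y => f y * g y :=
  hf.integrable_mul hg

theorem integral_add_sq_of_memLp {f g : V2 → ℝ} (hf : MemLp f 2) (hg : MemLp g 2) :
    ∫ y, (f y + g y) ^ 2 = (∫ y, f y ^ 2) + (∫ y, g y ^ 2) + 2 * ∫ y, f y * g y := by
  rw [← integral_const_mul, ← integral_add hf.integrable_sq hg.integrable_sq,
    ← integral_add (hf.integrable_sq.fun_add hg.integrable_sq)
      ((hf.integrable_mul_two hg).const_mul 2)]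
  exact integral_congr_ae (.of_forall fun y => by ring)

variable {A B Pf Q : Fin 2 → V2 → ℝ}

theorem HasSqIntegrableGrad.fderiv_add (hA : HasSqIntegrableGrad A) (hB : HasSqIntegrableGrad B)
    (j : Fin 2) (y e : V2) :
    fderiv ℝ (fun y => A j y + B j y) y e = fderiv ℝ (A j) y e + fderiv ℝ (B j) y e := by
  rw [fderiv_fun_add (hA.differentiable j y) (hB.differentiable j y)]
  rfl

theorem HasSqIntegrableGrad.add (hA : HasSqIntegrableGrad A) (hB : HasSqIntegrableGrad B) :
    HasSqIntegrableGrad fun j y => A j y + B j y where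
  differentiable j := (hA.differentiable j).add (hB.differentiable j)
  memLp_fderiv j e := by
    simp_rw [hA.fderiv_add hB]
    exact (hA.memLp_fderiv j e).add (hB.memLp_fderiv j e)

theorem HasSqIntegrableGrad.integral_sum_sq_add_gradSq (hA : HasSqIntegrableGrad A)
    (hP : ∀ j, MemLp (Pf j) 2) :
    ∫ y, ((∑ j, Pf j y ^ 2) + gradSq A y) =
      ∑ j, (∫ y, Pf j y ^ 2) + ∑ j, ∑ i, ∫ y, fderiv ℝ (A j) y (e2 i) ^ 2 := by
  have h1 : ∀ j, Integrable fun y => Pf j y ^ 2 := fun j => (hP j).integrable_sq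
  have h2 : ∀ j i, Integrable fun y => fderiv ℝ (A j) y (e2 i) ^ 2 := fun j i =>
    (hA.memLp_fderiv j (e2 i)).integrable_sq
  simp only [gradSq]
  rw [integral_add (integrable_finsetSum _ fun j _ => h1 j)
      (integrable_finsetSum _ fun i _ => integrable_finsetSum _ fun j _ => h2 j i),
    integral_finsetSum _ fun j _ => h1 j,
    integral_finsetSum _ fun i _ => integrable_finsetSum _ fun j _ => h2 j i,
    Finset.sum_comm (γ := Fin 2)]
  congr 1
  exact Finset.sum_congr rfl fun i _ => integral_finsetSum _ fun j _ => h2 j i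

theorem fieldEnergy_add (hA : HasSqIntegrableGrad A) (hB : HasSqIntegrableGrad B)
    (hP : ∀ j, MemLp (Pf j) 2) (hQ : ∀ j, MemLp (Q j) 2) :
    fieldEnergy (fun j y => A j y + B j y) (fun j y => Pf j y + Q j y) =
      fieldEnergy A Pf + fieldEnergy B Q + ∑ j, (∫ y, Pf j y * Q j y) +
        ∑ j, ∑ i, ∫ y, fderiv ℝ (A j) y (e2 i) * fderiv ℝ (B j) y (e2 i) := by
  have hPQ : ∀ j, MemLp (fun y => Pf j y + Q j y) 2 := fun j => (hP j).add (hQ j)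
  simp only [fieldEnergy]
  rw [(hA.add hB).integral_sum_sq_add_gradSq hPQ,
    hA.integral_sum_sq_add_gradSq hP, hB.integral_sum_sq_add_gradSq hQ]
  simp_rw [hA.fderiv_add hB, integral_add_sq_of_memLp (hP _) (hQ _),
    integral_add_sq_of_memLp (hA.memLp_fderiv _ _) (hB.memLp_fderiv _ _)]
  simp only [Finset.sum_add_distrib, ← Finset.mul_sum]
  ring

theorem HasSqIntegrableGrad.momTerm_eq (hA : HasSqIntegrableGrad A) (hP : ∀ j, MemLp (Pf j) 2)
    (j : Fin 2) : momTerm A Pf j = ∑ l, ∫ y, Pf l y * fderiv ℝ (A l) y (e2 j) :=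
  integral_finsetSum _ fun l _ => (hP l).integrable_mul_two (hA.memLp_fderiv l (e2 j))

theorem momTerm_add (hA : HasSqIntegrableGrad A) (hB : HasSqIntegrableGrad B)
    (hP : ∀ j, MemLp (Pf j) 2) (hQ : ∀ j, MemLp (Q j) 2) (j : Fin 2) :
    momTerm (fun j y => A j y + B j y) (fun j y => Pf j y + Q j y) j =
      momTerm A Pf j + momTerm A Q j + momTerm B Pf j + momTerm B Q j := by
  have hPQ : ∀ j, MemLp (fun y => Pf j y + Q j y) 2 := fun j => (hP j).add (hQ j)
  rw [(hA.add hB).momTerm_eq hPQ, hA.momTerm_eq hP, hA.momTerm_eq hQ,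
    hB.momTerm_eq hP, hB.momTerm_eq hQ, ← Finset.sum_add_distrib, ← Finset.sum_add_distrib,
    ← Finset.sum_add_distrib]
  refine Finset.sum_congr rfl fun l _ => ?_
  have i1 := (hP l).integrable_mul_two (hA.memLp_fderiv l (e2 j))
  have i2 := (hQ l).integrable_mul_two (hA.memLp_fderiv l (e2 j))
  have i3 := (hP l).integrable_mul_two (hB.memLp_fderiv l (e2 j))
  have i4 := (hQ l).integrable_mul_two (hB.memLp_fderiv l (e2 j))
  rw [← integral_add i1 i2, ← integral_add (i1.fun_add i2) i3,
    ← integral_add ((i1.fun_add i2).fun_add i3) i4]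
  refine integral_congr_ae (.of_forall fun y => ?_)
  simp only [hA.fderiv_add hB]
  ring

theorem map_eq_sum_apply_mul (L : V2 →L[ℝ] ℝ) (v : V2) : L v = ∑ j, v j * L (e2 j) := by
  have : v = ∑ j, v j • e2 j := by
    ext i
    fin_cases i <;> simp [e2]
  conv_lhs => rw [this]
  simp

theorem HasSqIntegrableGrad.sum_mul_momTerm (hA : HasSqIntegrableGrad A)
    (hP : ∀ j, MemLp (Pf j) 2) (v : V2) :
    ∑ j, v j * momTerm A Pf j = ∑ l, ∫ y, Pf l y * fderiv ℝ (A l) y v := by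
  simp_rw [hA.momTerm_eq hP, Finset.mul_sum]
  rw [Finset.sum_comm]
  refine Finset.sum_congr rfl fun l _ => ?_
  simp_rw [← integral_const_mul]
  rw [← integral_finsetSum _ fun j _ =>
    ((hP l).integrable_mul_two (hA.memLp_fderiv l (e2 j))).const_mul (v j)]
  refine integral_congr_ae (.of_forall fun y => ?_)
  simp only [map_eq_sum_apply_mul _ v, Finset.mul_sum]
  exact Finset.sum_congr rfl fun j _ => by ring

theorem chargeTerm_add {ρ : V2 → ℝ} (j : Fin 2) (hA : Integrable fun y => A j y * ρ y)
    (hB : Integrable fun y => B j y * ρ y) :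
    chargeTerm ρ (fun j y => A j y + B j y) j = chargeTerm ρ A j + chargeTerm ρ B j := by
  simp only [chargeTerm, add_mul]
  exact integral_add hA hB

theorem angTerm_add {ρ : V2 → ℝ} (hA : Integrable fun y => (y 1 * A 0 y - y 0 * A 1 y) * ρ y)
    (hB : Integrable fun y => (y 1 * B 0 y - y 0 * B 1 y) * ρ y) :
    angTerm ρ (fun j y => A j y + B j y) = angTerm ρ A + angTerm ρ B := by
  simp only [angTerm]
  rw [← integral_add hA hB]
  exact integral_congr_ae (.of_forall fun y => by ring)

end FiniteEnergy

theorem integrable_angTerm {ρ : 𝓢(V2, ℝ)} {A : Fin 2 → V2 → ℝ}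
    (h : ∀ (j : Fin 2) {f : V2 → ℝ}, Integrable f → Integrable fun y => f y * A j y) :
    Integrable fun y => (y 1 * A 0 y - y 0 * A 1 y) * ρ y := by
  refine ((h 0 (integrable_coord_mul ρ 1)).sub (h 1 (integrable_coord_mul ρ 0))).congr
    (.of_forall fun y => ?_)
  simp only [Pi.sub_apply]
  ring

theorem SchwartzMap.integrable_mul_apply (b : 𝓢(V2, ℝ)) {f : V2 → ℝ} (hf : Integrable f) :
    Integrable fun y => f y * b y :=
  hf.mul_bdd b.continuous.aestronglyMeasurable (.of_forall fun y => norm_le_seminorm ℝ _ y)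

/-- exact expansion of the increment of the reduced Hamiltonian at the
soliton, for solenoidal Schwartz perturbations `a, π`. -/
theorem hamiltonian_increment_expansion
    (ρ : SchwartzMap V2 ℝ)
    (hrad : ∀ x y : V2, ‖x‖ = ‖y‖ → ρ x = ρ y)
    (hneu : (∫ x : V2, ρ x) = 0)
    (m I : ℝ) (hm : 0 < m) (hI : 0 < I)
    (v : V2) (hv : ‖v‖ < 1) (ω : ℝ)
    (a π : Fin 2 → SchwartzMap V2 ℝ)
    (hdiva : ∀ y : V2, (∑ j, fderiv ℝ (⇑(a j)) y (e2 j)) = 0)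
    (hdivπ : ∀ y : V2, (∑ j, fderiv ℝ (⇑(π j)) y (e2 j)) = 0) :
    Hred m I (⇑ρ) (Psol (⇑ρ) m v ω) (Msol (⇑ρ) I v ω)
        (fun j y => Asol (⇑ρ) v ω j y + a j y)
        (fun j y => Pisol (⇑ρ) v ω j y + π j y)
      - Hred m I (⇑ρ) (Psol (⇑ρ) m v ω) (Msol (⇑ρ) I v ω)
        (Asol (⇑ρ) v ω) (Pisol (⇑ρ) v ω)
      = (1 / 2) * (∫ y : V2, ((∑ j, (π j y) ^ 2) + gradSq (fun j => ⇑(a j)) y))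
        + (∫ y : V2, ∑ j, π j y * fderiv ℝ (⇑(a j)) y v)
        + (1 / (2 * m)) * (∑ j,
            (momTerm (Asol (⇑ρ) v ω) (fun l => ⇑(π l)) j
              + momTerm (fun l => ⇑(a l)) (Pisol (⇑ρ) v ω) j
              + momTerm (fun l => ⇑(a l)) (fun l => ⇑(π l)) j
              - chargeTerm (⇑ρ) (fun l => ⇑(a l)) j) ^ 2)
        + (1 / (2 * I)) * (angTerm (⇑ρ) (fun l => ⇑(a l))) ^ 2 := by
  have hA : HasSqIntegrableGrad (Asol ρ v ω) :=
    ⟨fun j y => differentiableAt_Asol ω hrad hneu hv j y, memLp_fderiv_Asol ω hrad hneu hv⟩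
  have ha := SchwartzMap.hasSqIntegrableGrad a
  have hP : ∀ j, MemLp (Pisol ρ v ω j) 2 := fun j => (hA.memLp_fderiv j v).neg
  have hp : ∀ j, MemLp (π j) 2 := fun j => (π j).memLp 2
  have hAint : ∀ (j : Fin 2) {f : V2 → ℝ}, Integrable f → Integrable fun y => f y * Asol ρ v ω j y :=
    fun j _ => integrable_mul_Asol ω hrad hneu hv j
  have haint : ∀ (j : Fin 2) {f : V2 → ℝ}, Integrable f → Integrable fun y => f y * a j y :=
    fun j _ => (a j).integrable_mul_apply
  have hcharge : ∀ j, chargeTerm ρ (fun j y => Asol ρ v ω j y + a j y) j =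
      chargeTerm ρ (Asol ρ v ω) j + chargeTerm ρ (fun j => a j) j := fun j =>
    chargeTerm_add j ((hAint j ρ.integrable).congr (.of_forall fun y => mul_comm _ _))
      ((haint j ρ.integrable).congr (.of_forall fun y => mul_comm _ _))
  have hang : angTerm ρ (fun j y => Asol ρ v ω j y + a j y) =
      angTerm ρ (Asol ρ v ω) + angTerm ρ (fun j => a j) :=
    angTerm_add (integrable_angTerm hAint) (integrable_angTerm haint)
  have hweak := soliton_weak_equation ω hrad hneu hv hdiva
  have hs1 := hA.sum_mul_momTerm hp v
  have hs2 := ha.sum_mul_momTerm hP v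
  have hs3 := ha.sum_mul_momTerm hp v
  have hlast : ∫ y, ∑ j, π j y * fderiv ℝ (a j) y v = ∑ j, ∫ y, π j y * fderiv ℝ (a j) y v :=
    integral_finsetSum _ fun j _ => (hp j).integrable_mul_two (ha.memLp_fderiv j v)
  have hcross : ∀ j, ∫ y, Pisol ρ v ω j y * π j y = -∫ y, π j y * fderiv ℝ (Asol ρ v ω j) y v := by
    intro j
    rw [← integral_neg]
    exact integral_congr_ae (.of_forall fun y => by simp only [Pisol]; ring)
  have hcross2 : ∀ j, ∫ y, Pisol ρ v ω j y * fderiv ℝ (a j) y v =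
      -∫ y, fderiv ℝ (Asol ρ v ω j) y v * fderiv ℝ (a j) y v := by
    intro j
    rw [← integral_neg]
    exact integral_congr_ae (.of_forall fun y => by simp only [Pisol]; ring)
  have hE : (1 / 2) * (∫ y : V2, ((∑ j, (π j y) ^ 2) + gradSq (fun j => ⇑(a j)) y)) =
    fieldEnergy (fun j => ⇑(a j)) (fun j => ⇑(π j)) := rfl
  simp only [Hred, Psol, Msol, fieldEnergy_add hA ha hP hp, momTerm_add hA ha hP hp, hcharge, hang,
    hE, hlast]
  simp only [Fin.sum_univ_two, hcross, hcross2] at *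
  field_simp
  linear_combination (2 * m * I) * (hweak + hs1 + hs2 + hs3)

end
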